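/- Let k be a field of characteristic zero and R a local k-algebra essentially of finite type. Then Ω_{R/k} has a rank (i.e., is locally free of constant rank at all associated primes of R) if and only if R is reduced and equidimensional. -/

import Mathlib

noncomputable section

/-- A module `M` has rank `e` if it is free of rank `e` locally at every associated
prime of `R`. -/
def hasRank (R M : Type) [CommRing R] [AddCommGroup M] [Module R M] (e : ℕ) : Prop :=
  ∀ (p : Ideal R) (hp : p.IsPrime), p ∈ associatedPrimes R R →
    letI := hp
    Module.Free (Localization.AtPrime p) (LocalizedModule p.primeCompl M) ∧
      Module.finrank (Localization.AtPrime p) (LocalizedModule p.primeCompl M) = e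

section

open IsLocalRing
open scoped TensorProduct

/-- The conormal sequence of a surjection onto a formally smooth algebra is injective on the left. -/
theorem KaehlerDifferential.kerCotangentToTensor_injective_of_formallySmooth
    (R P S : Type*) [CommRing R] [CommRing P] [CommRing S] [Algebra R P] [Algebra P S]
    [Algebra R S] [IsScalarTower R P S] [Algebra.FormallySmooth R S]
    (hf : Function.Surjective (algebraMap P S)) :
    Function.Injective (KaehlerDifferential.kerCotangentToTensor R P S) := by
  have hk : IsNilpotent (RingHom.ker (IsScalarTower.toAlgHom R P S).kerSquareLift.toRingHom) := by
    refine ⟨2, ?_⟩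
    rw [AlgHom.ker_kerSquareLift, Ideal.cotangentIdeal_square]
    rfl
  let g := Algebra.FormallySmooth.liftOfSurjective (R := R) (AlgHom.id R S)
    (IsScalarTower.toAlgHom R P S).kerSquareLift (by
      intro x
      obtain ⟨y, rfl⟩ := hf x
      exact ⟨Ideal.Quotient.mk _ y, rfl⟩) hk
  have hg : (IsScalarTower.toAlgHom R P S).kerSquareLift.comp g = AlgHom.id R S := by
    ext x
    exact Algebra.FormallySmooth.liftOfSurjective_apply (R := R) (AlgHom.id R S)
      (IsScalarTower.toAlgHom R P S).kerSquareLift _ hk x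
  obtain ⟨l, hl⟩ := (retractionKerCotangentToTensorEquivSection hf).symm ⟨g, hg⟩
  exact Function.LeftInverse.injective (g := l) fun x => LinearMap.congr_fun hl x

/-- In characteristic zero, an element of the maximal ideal that some derivation sends to a unit is
a nonzerodivisor. -/
theorem IsLocalRing.mem_nonZeroDivisors_of_isUnit_derivation {k S : Type*} [Field k] [CharZero k]
    [CommRing S] [IsLocalRing S] [IsNoetherianRing S] [Algebra k S] (D : Derivation k S S)
    {t : S} (ht : t ∈ IsLocalRing.maximalIdeal S) (hD : IsUnit (D t)) :
    t ∈ nonZeroDivisors S := by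
  rw [mem_nonZeroDivisors_iff_right]
  intro s hs
  have key : ∀ n : ℕ, ∃ a, s = t ^ n * a := by
    intro n
    induction n with
    | zero => exact ⟨s, by simp⟩
    | succ n ih =>
      obtain ⟨a, rfl⟩ := ih
      have h0 : t ^ (n + 1) * a = 0 := by rw [← hs]; ring
      have h1 : D (t ^ (n + 1) * a) = 0 := by rw [h0, map_zero]
      rw [Derivation.leibniz, Derivation.leibniz_pow] at h1
      have hn : IsUnit ((n + 1 : ℕ) : S) := by
        have : IsUnit ((n + 1 : ℕ) : k) := isUnit_iff_ne_zero.2 (by exact_mod_cast n.succ_ne_zero)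
        simpa using this.map (algebraMap k S)
      obtain ⟨u, hu⟩ := hn.mul hD
      refine ⟨-(↑u⁻¹ * D a), ?_⟩
      simp only [smul_eq_mul, nsmul_eq_mul, Nat.add_sub_cancel] at h1
      have h2 : t ^ n * a * u = - (t ^ (n + 1) * D a) := by
        rw [hu]; linear_combination h1
      calc t ^ n * a = t ^ n * a * u * ↑u⁻¹ := by simp [mul_assoc]
        _ = _ := by rw [h2]; ring
  have hmem : s ∈ ⨅ n : ℕ, IsLocalRing.maximalIdeal S ^ n := by
    rw [Ideal.mem_iInf]
    intro n
    obtain ⟨a, rfl⟩ := key n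
    exact Ideal.mul_mem_right _ _ (Ideal.pow_mem_pow ht n)
  rwa [Ideal.iInf_pow_eq_bot_of_isLocalRing _ Ideal.IsPrime.ne_top'] at hmem

theorem IsLocalRing.kerCotangentToTensor_residueField_injective (k S : Type*) [Field k] [CharZero k]
    [CommRing S] [IsLocalRing S] [Algebra k S] [Algebra.EssFiniteType k S] :
    Function.Injective (KaehlerDifferential.kerCotangentToTensor k S (ResidueField S)) :=
  have : Algebra.EssFiniteType k (ResidueField S) := .comp k S _
  KaehlerDifferential.kerCotangentToTensor_injective_of_formallySmooth k S (ResidueField S)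
    residue_surjective

/-- The minimal number of generators of the module of differentials is the sum of the embedding
dimension and the rank of the differentials of the residue field. -/
theorem IsLocalRing.finrank_residueField_tensor_kaehlerDifferential (k S : Type*) [Field k]
    [CharZero k] [CommRing S] [IsLocalRing S] [Algebra k S] [Algebra.EssFiniteType k S] :
    Module.finrank (ResidueField S) (ResidueField S ⊗[S] Ω[S⁄k]) =
      Module.finrank (ResidueField S) (CotangentSpace S) +
        Module.finrank (ResidueField S) Ω[ResidueField S⁄k] := by
  have hs : Function.Surjective (algebraMap S (ResidueField S)) := residue_surjective
  have hk : RingHom.ker (algebraMap S (ResidueField S)) = maximalIdeal S := ker_residue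
  have e₀ : Nonempty ((RingHom.ker (algebraMap S (ResidueField S))).Cotangent ≃ₗ[S]
      (maximalIdeal S).Cotangent) := by rw [hk]; exact ⟨.refl _ _⟩
  obtain ⟨e₀⟩ := e₀
  let f : CotangentSpace S →ₗ[ResidueField S] ResidueField S ⊗[S] Ω[S⁄k] :=
    LinearMap.extendScalarsOfSurjective hs
      (KaehlerDifferential.kerCotangentToTensor k S (ResidueField S) ∘ₗ e₀.symm.toLinearMap)
  have hf : Function.Injective f :=
    (kerCotangentToTensor_residueField_injective k S).comp e₀.symm.injective
  let g := KaehlerDifferential.mapBaseChange k S (ResidueField S)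
  have hg : Function.Surjective g := KaehlerDifferential.mapBaseChange_surjective k S _ hs
  have hr : LinearMap.range f = LinearMap.ker g := by
    ext x
    have := KaehlerDifferential.exact_kerCotangentToTensor_mapBaseChange k S (ResidueField S) hs x
    rw [LinearMap.mem_ker, this]
    constructor
    · rintro ⟨y, rfl⟩; exact ⟨e₀.symm y, rfl⟩
    · rintro ⟨y, rfl⟩; exact ⟨e₀ y, congr_arg (KaehlerDifferential.kerCotangentToTensor k S
        (ResidueField S)) (e₀.symm_apply_apply y)⟩
  rw [← LinearMap.finrank_range_add_finrank_ker g, ← hr, LinearMap.finrank_range_of_inj hf,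
    LinearMap.range_eq_top.2 hg, finrank_top, add_comm]

theorem IsLocalRing.exists_isUnit_derivation {k S : Type*} [Field k] [CharZero k]
    [CommRing S] [IsLocalRing S] [Algebra k S] [Algebra.EssFiniteType k S]
    [Module.Free S Ω[S⁄k]] {t : S} (ht : t ∈ maximalIdeal S) (ht' : t ∉ maximalIdeal S ^ 2) :
    ∃ D : Derivation k S S, IsUnit (D t) := by
  let b := Module.Free.chooseBasis S Ω[S⁄k]
  by_contra! H
  have hc : ∀ i, b.repr (KaehlerDifferential.D k S t) i ∈ maximalIdeal S := fun i =>
    (mem_maximalIdeal _).2 (H ((b.coord i).compDer (KaehlerDifferential.D k S)))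
  have hz : (1 : ResidueField S) ⊗ₜ[S] KaehlerDifferential.D k S t = 0 := by
    rw [← b.linearCombination_repr (KaehlerDifferential.D k S t), Finsupp.linearCombination_apply,
      Finsupp.sum, TensorProduct.tmul_sum]
    refine Finset.sum_eq_zero fun i _ => ?_
    rw [← TensorProduct.smul_tmul, Algebra.smul_def, ResidueField.algebraMap_eq,
      (residue_eq_zero_iff _).2 (hc i), zero_mul, TensorProduct.zero_tmul]
  have hk : RingHom.ker (algebraMap S (ResidueField S)) = maximalIdeal S := ker_residue
  let t' : RingHom.ker (algebraMap S (ResidueField S)) := ⟨t, hk ▸ ht⟩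
  have := (injective_iff_map_eq_zero _).1 (kerCotangentToTensor_residueField_injective k S)
    (Ideal.toCotangent _ t') (by
      rw [KaehlerDifferential.kerCotangentToTensor_toCotangent]
      exact hz)
  rw [Ideal.toCotangent_eq_zero] at this
  exact ht' ((congr_arg (fun I : Ideal S => t ∈ I ^ 2) hk).mp this)

/-- Over a field of characteristic zero, a local ring of depth zero with free module of
differentials is a field. -/
theorem IsLocalRing.maximalIdeal_eq_bot_of_free_kaehlerDifferential {k S : Type*} [Field k]
    [CharZero k] [CommRing S] [IsLocalRing S] [IsNoetherianRing S] [Algebra k S]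
    [Algebra.EssFiniteType k S] [Module.Free S Ω[S⁄k]] {x : S} (hx : x ≠ 0)
    (hm : ∀ t ∈ maximalIdeal S, t * x = 0) : maximalIdeal S = ⊥ := by
  by_contra hne
  have h2 : ¬ maximalIdeal S ≤ maximalIdeal S ^ 2 := by
    intro h
    refine hne (Submodule.eq_bot_of_le_smul_of_le_jacobson_bot (maximalIdeal S) (maximalIdeal S)
      (IsNoetherian.noetherian _) ?_ (maximalIdeal_le_jacobson _))
    rwa [smul_eq_mul, ← sq]
  obtain ⟨t, ht, ht'⟩ := SetLike.not_le_iff_exists.1 h2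
  obtain ⟨D, hD⟩ := exists_isUnit_derivation (k := k) ht ht'
  exact hx (mem_nonZeroDivisors_iff_left.1
    (mem_nonZeroDivisors_of_isUnit_derivation D ht hD) x (hm t ht))

/-- A formally étale algebra has the same rank of differentials, when these are free over the
source. -/
theorem KaehlerDifferential.finrank_eq_of_formallyEtale (k A B : Type*) [CommRing k] [CommRing A]
    [CommRing B] [Nontrivial B] [Nontrivial A] [Algebra k A] [Algebra A B] [Algebra k B]
    [IsScalarTower k A B] [Algebra.FormallyEtale A B] [Module.Free A Ω[A⁄k]] :
    Module.finrank B Ω[B⁄k] = Module.finrank A Ω[A⁄k] := by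
  rw [← (tensorKaehlerEquivOfFormallyEtale k A B).finrank_eq, Module.finrank_baseChange]

theorem KaehlerDifferential.finrank_eq_of_isAlgebraic (k K L : Type*) [Field k] [CharZero k]
    [Field K] [Field L] [Algebra k K] [Algebra K L] [Algebra k L] [IsScalarTower k K L]
    [Algebra.IsAlgebraic K L] :
    Module.finrank L Ω[L⁄k] = Module.finrank K Ω[K⁄k] := by
  have : CharZero K := charZero_of_injective_algebraMap (algebraMap k K).injective
  have : Algebra.FormallyEtale K L := .of_isSeparable K L
  exact finrank_eq_of_formallyEtale k K L

/-- Heights are preserved by contraction along integral extensions satisfying going down. -/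
theorem Ideal.height_under_of_isIntegral_of_hasGoingDown {A B : Type*} [CommRing A] [CommRing B]
    [IsNoetherianRing A] [IsNoetherianRing B] [Algebra A B] [Algebra.IsIntegral A B]
    [Algebra.HasGoingDown A B] (q : Ideal B) [q.IsPrime] : (q.under A).height = q.height := by
  rw [Ideal.height_eq_height_add_of_liesOver_of_hasGoingDown (q.under A) q]
  have : (q.map (Ideal.Quotient.mk ((q.under A).map (algebraMap A B)))).height = 0 := by
    have hle : RingHom.ker (Ideal.Quotient.mk ((q.under A).map (algebraMap A B))) ≤ q := by
      rw [Ideal.mk_ker]; exact Ideal.map_comap_le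
    have := Ideal.map_isPrime_of_surjective Ideal.Quotient.mk_surjective hle
    rw [Ideal.height_eq_zero_iff]
    have h : q ∈ ((q.under A).map (algebraMap A B)).minimalPrimes :=
      Ideal.IsIntegral.mem_minimalPrimes_map_under q
    rw [Ideal.minimalPrimes_eq_comap] at h
    obtain ⟨J, hJ, hq⟩ := h
    have hJq := Ideal.map_comap_of_surjective _ Ideal.Quotient.mk_surjective J
    rw [hq] at hJq
    rwa [hJq]
  rw [this, add_zero]

/-- The dimension formula at a prime of a polynomial ring. -/
theorem MvPolynomial.height_add_finrank_kaehlerDifferential_residueField {k : Type*} [Field k]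
    [CharZero k] {n : ℕ} (p : Ideal (MvPolynomial (Fin n) k)) [p.IsPrime] :
    p.height + Module.finrank p.ResidueField Ω[p.ResidueField⁄k] = n := by
  have : Algebra.FormallyEtale (MvPolynomial (Fin n) k) (Localization.AtPrime p) :=
    .of_isLocalization p.primeCompl
  have : Algebra.EssFiniteType (MvPolynomial (Fin n) k) (Localization.AtPrime p) :=
    .of_isLocalization _ p.primeCompl
  have : Algebra.EssFiniteType k (Localization.AtPrime p) :=
    .comp k (MvPolynomial (Fin n) k) _
  have : Module.Free (MvPolynomial (Fin n) k) Ω[MvPolynomial (Fin n) k⁄k] :=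
    .of_basis (KaehlerDifferential.mvPolynomialBasis k (Fin n))
  have : Module.Free (Localization.AtPrime p) Ω[Localization.AtPrime p⁄k] :=
    .of_equiv (KaehlerDifferential.tensorKaehlerEquivOfFormallyEtale k
      (MvPolynomial (Fin n) k) (Localization.AtPrime p))
  have h1 := IsLocalRing.finrank_residueField_tensor_kaehlerDifferential k (Localization.AtPrime p)
  rw [Module.finrank_baseChange, KaehlerDifferential.finrank_eq_of_formallyEtale k
      (MvPolynomial (Fin n) k) (Localization.AtPrime p),
    Module.finrank_eq_card_basis (KaehlerDifferential.mvPolynomialBasis k (Fin n)),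
    Fintype.card_fin] at h1
  have h2 := (IsRegularLocalRing.iff_finrank_cotangentSpace _).1
    (IsRegularRing.isRegularLocalRing_localization (R := MvPolynomial (Fin n) k) p)
  rw [IsLocalization.AtPrime.ringKrullDim_eq_height p (Localization.AtPrime p)] at h2
  have h3 : p.height = Module.finrank (ResidueField (Localization.AtPrime p))
    (CotangentSpace (Localization.AtPrime p)) := by exact_mod_cast h2.symm
  rw [h3]
  exact_mod_cast h1.symm

/-- A field all of whose elements are quotients of elements integral over `P` is algebraic over
any subfield containing the image of `P`. -/
theorem Algebra.IsAlgebraic.of_forall_eq_div {P B F L : Type*} [CommRing P] [CommRing B] [Field F]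
    [Field L] [Algebra P B] [Algebra P F] [Algebra P L] [Algebra B L] [Algebra F L]
    [IsScalarTower P B L] [IsScalarTower P F L] [Algebra.IsIntegral P B]
    (h : ∀ x : L, ∃ b s : B, x = algebraMap B L b / algebraMap B L s) :
    Algebra.IsAlgebraic F L := by
  have key (b : B) : IsAlgebraic F (algebraMap B L b) :=
    ((Algebra.IsIntegral.isIntegral (R := P) b).algebraMap.tower_top (A := F)).isAlgebraic
  refine ⟨fun x => ?_⟩
  obtain ⟨b, s, rfl⟩ := h x
  rw [div_eq_mul_inv]
  exact (key b).mul (key s).inv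

theorem MvPolynomial.height_ker_add_finrank_kaehlerDifferential {k : Type*} [Field k]
    [CharZero k] {n : ℕ} {B L : Type*} [CommRing B] [Algebra (MvPolynomial (Fin n) k) B]
    [Algebra.IsIntegral (MvPolynomial (Fin n) k) B] [Field L] [Algebra k L] [Algebra B L]
    [Algebra (MvPolynomial (Fin n) k) L] [IsScalarTower (MvPolynomial (Fin n) k) B L]
    [IsScalarTower k (MvPolynomial (Fin n) k) L]
    (h : ∀ x : L, ∃ b s : B, x = algebraMap B L b / algebraMap B L s) :
    (RingHom.ker (algebraMap (MvPolynomial (Fin n) k) L)).height +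
      Module.finrank L Ω[L⁄k] = n := by
  set p := RingHom.ker (algebraMap (MvPolynomial (Fin n) k) L) with hp
  have : p.IsPrime := RingHom.ker_isPrime _
  let f : p.ResidueField →ₐ[MvPolynomial (Fin n) k] L :=
    Ideal.ResidueField.liftₐ p (Algebra.ofId _ L) le_rfl (by
      intro x hx
      exact isUnit_iff_ne_zero.2 hx)
  let := f.toRingHom.toAlgebra
  have : IsScalarTower (MvPolynomial (Fin n) k) p.ResidueField L :=
    .of_algebraMap_eq fun x => (f.commutes x).symm
  have : IsScalarTower k p.ResidueField L := .of_algebraMap_eq fun x => by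
    rw [IsScalarTower.algebraMap_apply k (MvPolynomial (Fin n) k) L,
      IsScalarTower.algebraMap_apply k (MvPolynomial (Fin n) k) p.ResidueField,
      ← IsScalarTower.algebraMap_apply _ p.ResidueField L]
  have : Algebra.IsAlgebraic p.ResidueField L :=
    .of_forall_eq_div (P := MvPolynomial (Fin n) k) h
  rw [KaehlerDifferential.finrank_eq_of_isAlgebraic k p.ResidueField L]
  exact height_add_finrank_kaehlerDifferential_residueField p

theorem IsLocalization.exists_eq_div_of_forall_exists_eq_div {B A L : Type*} [CommRing B]
    [CommRing A] [Field L] [Algebra B A] [Algebra A L] [Algebra B L] [IsScalarTower B A L]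
    (M : Submonoid B) [IsLocalization M A]
    (h : ∀ x : L, ∃ a b : A, x = algebraMap A L a / algebraMap A L b) (x : L) :
    ∃ b s : B, x = algebraMap B L b / algebraMap B L s := by
  obtain ⟨a, c, rfl⟩ := h x
  obtain ⟨b, s, rfl⟩ := IsLocalization.exists_mk'_eq M a
  obtain ⟨b', s', rfl⟩ := IsLocalization.exists_mk'_eq M c
  have hs (b : B) (s : M) : algebraMap A L (IsLocalization.mk' A b s) =
      algebraMap B L b / algebraMap B L s := by
    have hu : algebraMap B L s ≠ 0 := by
      rw [IsScalarTower.algebraMap_apply B A L]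
      exact ((IsLocalization.map_units A s).map (algebraMap A L)).ne_zero
    rw [eq_div_iff hu, IsScalarTower.algebraMap_apply B A L, ← map_mul,
      IsLocalization.mk'_spec, ← IsScalarTower.algebraMap_apply B A L]
  exact ⟨b * s', s * b', by rw [hs, hs, div_div_div_eq, map_mul, map_mul]⟩

/-- The dimension formula for a local domain `A` essentially of finite type over a field, with the
rank of the module of differentials playing the role of the transcendence degree. -/
theorem ringKrullDim_add_finrank_kaehlerDifferential_residueField (k A K : Type*) [Field k]
    [CharZero k] [CommRing A] [IsDomain A] [IsLocalRing A] [Algebra k A] [Algebra.EssFiniteType k A]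
    [Field K] [Algebra A K] [Algebra k K] [IsScalarTower k A K] [IsFractionRing A K] :
    ringKrullDim A + Module.finrank (ResidueField A) Ω[ResidueField A⁄k] =
      Module.finrank K Ω[K⁄k] := by
  let B := Algebra.EssFiniteType.subalgebra k A
  let M : Submonoid B := Algebra.EssFiniteType.submonoid k A
  have : IsLocalization M A := Algebra.EssFiniteType.isLocalization k A
  obtain ⟨n, g, hg, hgf⟩ := exists_finite_inj_algHom_of_fg k B
  let := g.toRingHom.toAlgebra
  have : Module.Finite (MvPolynomial (Fin n) k) B := hgf
  have : FaithfulSMul (MvPolynomial (Fin n) k) B := (faithfulSMul_iff_algebraMap_injective _ _).2 hg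
  have : IsNoetherianRing B := Algebra.FiniteType.isNoetherianRing k B
  have : IsScalarTower k (MvPolynomial (Fin n) k) B :=
    .of_algebraMap_eq fun x => (g.commutes x).symm
  let : Algebra (MvPolynomial (Fin n) k) A := .compHom A (algebraMap (MvPolynomial (Fin n) k) B)
  have : IsScalarTower (MvPolynomial (Fin n) k) B A := .of_algebraMap_eq fun _ => rfl
  let : Algebra (MvPolynomial (Fin n) k) K := .compHom K (algebraMap (MvPolynomial (Fin n) k) A)
  have : IsScalarTower (MvPolynomial (Fin n) k) A K := .of_algebraMap_eq fun _ => rfl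
  have : IsScalarTower k (MvPolynomial (Fin n) k) A := .of_algebraMap_eq fun x => by
    rw [IsScalarTower.algebraMap_apply k B A,
      IsScalarTower.algebraMap_apply k (MvPolynomial (Fin n) k) B]
    rfl
  have : IsScalarTower k (MvPolynomial (Fin n) k) K := .of_algebraMap_eq fun x => by
    rw [IsScalarTower.algebraMap_apply k A K,
      IsScalarTower.algebraMap_apply k (MvPolynomial (Fin n) k) A]
    rfl
  have : IsScalarTower (MvPolynomial (Fin n) k) B K := .of_algebraMap_eq fun _ => rfl
  have : IsScalarTower (MvPolynomial (Fin n) k) B (ResidueField A) := .of_algebraMap_eq fun _ => rfl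
  have hK := MvPolynomial.height_ker_add_finrank_kaehlerDifferential (k := k) (n := n)
    (IsLocalization.exists_eq_div_of_forall_exists_eq_div M (A := A) (L := K) fun x => by
      obtain ⟨a, b, -, h⟩ := IsFractionRing.div_surjective (A := A) x
      exact ⟨a, b, h.symm⟩)
  have hκ := MvPolynomial.height_ker_add_finrank_kaehlerDifferential (k := k) (n := n)
    (IsLocalization.exists_eq_div_of_forall_exists_eq_div M (A := A) (L := ResidueField A)
      fun x => by
      obtain ⟨a, rfl⟩ := residue_surjective x
      exact ⟨a, 1, by simp⟩)
  have hk : RingHom.ker (algebraMap (MvPolynomial (Fin n) k) K) = ⊥ := by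
    rw [← RingHom.injective_iff_ker_eq_bot, IsScalarTower.algebraMap_eq _ A K,
      IsScalarTower.algebraMap_eq _ B A]
    exact (IsFractionRing.injective A K).comp (Subtype.val_injective.comp hg)
  have hq : RingHom.ker (algebraMap (MvPolynomial (Fin n) k) (ResidueField A)) =
      ((maximalIdeal A).under B).under (MvPolynomial (Fin n) k) := by
    ext x
    rw [RingHom.mem_ker, IsScalarTower.algebraMap_apply _ A (ResidueField A),
      ResidueField.algebraMap_eq, residue_eq_zero_iff,
      IsScalarTower.algebraMap_apply _ B A]
    rfl
  rw [hk, Ideal.height_bot, zero_add] at hK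
  rw [hq, Ideal.height_under_of_isIntegral_of_hasGoingDown, IsLocalization.height_under M] at hκ
  rw [← maximalIdeal_height_eq_ringKrullDim]
  rw [← hK] at hκ
  exact_mod_cast hκ

theorem ringKrullDim_quotient_add_finrank_kaehlerDifferential (k : Type*) {R : Type*} [Field k]
    [CharZero k] [CommRing R] [IsLocalRing R] [Algebra k R] [Algebra.EssFiniteType k R]
    (p : Ideal R) [p.IsPrime] :
    ringKrullDim (R ⧸ p) + Module.finrank (ResidueField R) Ω[ResidueField R⁄k] =
      Module.finrank p.ResidueField Ω[p.ResidueField⁄k] := by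
  have hs : Function.Surjective (algebraMap R (R ⧸ p)) := Ideal.Quotient.mk_surjective
  have : IsLocalRing (R ⧸ p) := .of_surjective' _ Ideal.Quotient.mk_surjective
  have : IsLocalHom (algebraMap R (R ⧸ p)) := .of_surjective _ hs
  have : Algebra.IsAlgebraic (ResidueField R) (ResidueField (R ⧸ p)) := by
    refine ⟨fun x => ?_⟩
    obtain ⟨y, rfl⟩ := residue_surjective x
    obtain ⟨z, rfl⟩ := hs y
    rw [← ResidueField.algebraMap_residue]
    exact isAlgebraic_algebraMap _
  rw [← KaehlerDifferential.finrank_eq_of_isAlgebraic k (ResidueField R) (ResidueField (R ⧸ p))]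
  exact ringKrullDim_add_finrank_kaehlerDifferential_residueField k (R ⧸ p) p.ResidueField

/-- The module of differentials commutes with localization. -/
def KaehlerDifferential.localizedModuleEquiv (k : Type*) {R : Type*} [CommRing k] [CommRing R]
    [Algebra k R] (M : Submonoid R) :
    LocalizedModule M Ω[R⁄k] ≃ₗ[Localization M] Ω[Localization M⁄k] :=
  (IsLocalizedModule.iso M
    (KaehlerDifferential.map k k R (Localization M))).extendScalarsOfIsLocalization
    M (Localization M)

theorem IsLocalRing.finrank_kaehlerDifferential_residueField_of_maximalIdeal_eq_bot (k : Type*)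
    {S : Type*} [Field k] [CommRing S] [IsLocalRing S] [Algebra k S] (h : maximalIdeal S = ⊥) :
    Module.Free S Ω[S⁄k] ∧
      Module.finrank (ResidueField S) Ω[ResidueField S⁄k] = Module.finrank S Ω[S⁄k] := by
  have hb : Function.Bijective (algebraMap S (ResidueField S)) := by
    refine ⟨?_, residue_surjective⟩
    rw [RingHom.injective_iff_ker_eq_bot, ← h]
    exact ker_residue
  have : Algebra.FormallyEtale S (ResidueField S) :=
    .of_equiv (AlgEquiv.ofBijective (Algebra.ofId S (ResidueField S)) hb)
  let := (isField_iff_maximalIdeal_eq.2 h).toField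
  have : Module.Free S Ω[S⁄k] := Module.Free.of_divisionRing S _
  exact ⟨this, KaehlerDifferential.finrank_eq_of_formallyEtale k S (ResidueField S)⟩

theorem Ideal.exists_ne_zero_mul_eq_zero_of_mem_associatedPrimes {R : Type*} [CommRing R]
    [IsNoetherianRing R] (p : Ideal R) [p.IsPrime] (hp : p ∈ associatedPrimes R R) :
    ∃ x : Localization.AtPrime p, x ≠ 0 ∧
      ∀ t ∈ maximalIdeal (Localization.AtPrime p), t * x = 0 := by
  obtain ⟨-, x, hx⟩ := isAssociatedPrime_iff.1 hp
  have hx' (a : R) : a ∈ p ↔ a * x = 0 := by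
    rw [hx, Submodule.mem_colon_singleton]; simp
  refine ⟨algebraMap R _ x, fun h => ?_, fun t ht => ?_⟩
  · obtain ⟨s, hs⟩ := (IsLocalization.map_eq_zero_iff p.primeCompl _ x).1 h
    exact s.2 ((hx' s).2 hs)
  · obtain ⟨a, s, rfl⟩ := IsLocalization.exists_mk'_eq p.primeCompl t
    have ha : a ∈ p := (IsLocalization.AtPrime.mk'_mem_maximal_iff _ p a s).1 ht
    rw [mul_comm, ← IsLocalization.mk'_one (M := p.primeCompl), ← IsLocalization.mk'_mul,
      mul_comm x, (hx' a).1 ha, IsLocalization.mk'_zero]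

theorem Ideal.maximalIdeal_localization_eq_bot_of_mem_associatedPrimes {R : Type*} [CommRing R]
    [IsNoetherianRing R] [IsReduced R] (p : Ideal R) [p.IsPrime] (hp : p ∈ associatedPrimes R R) :
    maximalIdeal (Localization.AtPrime p) = ⊥ := by
  obtain ⟨x, hx, h⟩ := p.exists_ne_zero_mul_eq_zero_of_mem_associatedPrimes hp
  have hu : IsUnit x := by
    by_contra hu
    have := h x ((mem_maximalIdeal _).2 hu)
    exact hx (IsReduced.eq_zero _ ⟨2, by rwa [sq]⟩)
  rw [eq_bot_iff]
  intro t ht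
  exact (hu.mul_left_eq_zero).1 (h t ht)

theorem Ideal.mem_minimalPrimes_of_maximalIdeal_localization_eq_bot {R : Type*} [CommRing R]
    (p : Ideal R) [p.IsPrime] (h : maximalIdeal (Localization.AtPrime p) = ⊥) :
    p ∈ minimalPrimes R := by
  rw [← Ideal.height_eq_zero_iff]
  have : (maximalIdeal (Localization.AtPrime p)).height = 0 := by rw [h, Ideal.height_bot]
  rw [← IsLocalization.height_under p.primeCompl, Localization.AtPrime.under_maximalIdeal] at this
  exact this

theorem mem_associatedPrimes_of_mem_minimalPrimes {R : Type*} [CommRing R] [IsNoetherianRing R]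
    {p : Ideal R} (hp : p ∈ minimalPrimes R) : p ∈ associatedPrimes R R := by
  apply Module.associatedPrimes.minimalPrimes_annihilator_subset_associatedPrimes R R
  rwa [Module.annihilator_eq_bot.2 inferInstance]

theorem isReduced_of_forall_mem_associatedPrimes {R : Type*} [CommRing R] [IsNoetherianRing R]
    (h : ∀ (p : Ideal R) [p.IsPrime], p ∈ associatedPrimes R R →
      maximalIdeal (Localization.AtPrime p) = ⊥) : IsReduced R := by
  refine ⟨fun x hx => ?_⟩
  by_contra h0
  obtain ⟨p, hp, hxp⟩ := exists_le_isAssociatedPrime_of_isNoetherianRing R x h0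
  have := hp.isPrime
  have hm : algebraMap R (Localization.AtPrime p) x ∈ maximalIdeal (Localization.AtPrime p) := by
    rw [mem_maximalIdeal]
    exact (hx.map (algebraMap R (Localization.AtPrime p))).not_isUnit
  rw [h p hp, Ideal.mem_bot] at hm
  obtain ⟨s, hs⟩ := (IsLocalization.map_eq_zero_iff p.primeCompl _ x).1 hm
  exact s.2 (hxp (Submodule.mem_colon_singleton.2 (by simpa using hs)))

theorem exists_mem_minimalPrimes_ringKrullDim_quotient_eq (R : Type*) [CommRing R]
    [IsNoetherianRing R] [IsLocalRing R] :
    ∃ p ∈ minimalPrimes R, ringKrullDim (R ⧸ p) = ringKrullDim R := by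
  obtain ⟨l, -, hl⟩ := (maximalIdeal R).exists_ltSeries_length_eq_height
  obtain ⟨p, hp, hpl⟩ := Ideal.exists_minimalPrimes_le (J := l.head.asIdeal) bot_le
  refine ⟨p, hp, (ringKrullDim_quotient_le p).antisymm ?_⟩
  let l' : LTSeries (PrimeSpectrum.zeroLocus (R := R) p) :=
    { length := l.length
      toFun := fun i => ⟨l i, hpl.trans (l.head_le i)⟩
      step := fun i => l.step i }
  rw [ringKrullDim_quotient, ← maximalIdeal_height_eq_ringKrullDim, ← hl]
  exact Order.LTSeries.length_le_krullDim l'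

theorem Ideal.free_localizedModule_kaehlerDifferential_of_maximalIdeal_eq_bot (k : Type*)
    {R : Type*} [Field k] [CharZero k] [CommRing R] [IsLocalRing R] [Algebra k R]
    [Algebra.EssFiniteType k R] (p : Ideal R) [p.IsPrime]
    (h : maximalIdeal (Localization.AtPrime p) = ⊥) :
    Module.Free (Localization.AtPrime p) (LocalizedModule p.primeCompl Ω[R⁄k]) ∧
      ringKrullDim (R ⧸ p) +
          Module.finrank (IsLocalRing.ResidueField R) Ω[IsLocalRing.ResidueField R⁄k] =
        Module.finrank (Localization.AtPrime p) (LocalizedModule p.primeCompl Ω[R⁄k]) := by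
  obtain ⟨h1, h2⟩ := finrank_kaehlerDifferential_residueField_of_maximalIdeal_eq_bot k h
  let e := KaehlerDifferential.localizedModuleEquiv k p.primeCompl
  refine ⟨.of_equiv e.symm, ?_⟩
  rw [ringKrullDim_quotient_add_finrank_kaehlerDifferential, e.finrank_eq]
  exact_mod_cast h2

end

/-- In characteristic zero, the module of differentials of a local algebra essentially of
finite type has a rank if and only if the algebra is reduced and equidimensional. -/
theorem kaehler_hasRank_iff (k R : Type) [Field k] [CharZero k] [CommRing R] [IsLocalRing R]
    [IsNoetherianRing R] [Algebra k R] [Algebra.EssFiniteType k R] :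
    (∃ e : ℕ, hasRank R (Ω[R⁄k]) e) ↔
      (IsReduced R ∧ ∀ p ∈ minimalPrimes R, ringKrullDim (R ⧸ p) = ringKrullDim R) := by
  constructor
  · rintro ⟨e, he⟩
    have hbot (p : Ideal R) [hp : p.IsPrime] (hpa : p ∈ associatedPrimes R R) :
        IsLocalRing.maximalIdeal (Localization.AtPrime p) = ⊥ := by
      obtain ⟨hfree, -⟩ := he p hp hpa
      obtain ⟨x, hx, hxm⟩ := p.exists_ne_zero_mul_eq_zero_of_mem_associatedPrimes hpa
      have : Module.Free (Localization.AtPrime p) Ω[Localization.AtPrime p⁄k] :=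
        .of_equiv (KaehlerDifferential.localizedModuleEquiv k p.primeCompl)
      exact IsLocalRing.maximalIdeal_eq_bot_of_free_kaehlerDifferential (k := k) hx hxm
    refine ⟨isReduced_of_forall_mem_associatedPrimes fun p _ => hbot p, ?_⟩
    have hdim (p : Ideal R) (hp : p ∈ minimalPrimes R) :
        ringKrullDim (R ⧸ p) +
          Module.finrank (IsLocalRing.ResidueField R) Ω[IsLocalRing.ResidueField R⁄k] = e := by
      have hpa := mem_associatedPrimes_of_mem_minimalPrimes hp
      have hpp : p.IsPrime := hp.isPrime
      rw [← (he p hpp hpa).2]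
      exact (p.free_localizedModule_kaehlerDifferential_of_maximalIdeal_eq_bot k (hbot p hpa)).2
    obtain ⟨q, hq, hqd⟩ := exists_mem_minimalPrimes_ringKrullDim_quotient_eq R
    intro p hp
    rw [← hqd]
    have h := (hdim p hp).trans (hdim q hq).symm
    exact (ENat.WithBot.add_natCast_cancel).1 h
  · rintro ⟨hred, hdim⟩
    obtain ⟨q, hq, -⟩ := exists_mem_minimalPrimes_ringKrullDim_quotient_eq R
    have hqp : q.IsPrime := hq.isPrime
    refine ⟨Module.finrank (Localization.AtPrime q) (LocalizedModule q.primeCompl Ω[R⁄k]),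
      fun p hp hpa => ?_⟩
    have hqbot := q.maximalIdeal_localization_eq_bot_of_mem_associatedPrimes
      (mem_associatedPrimes_of_mem_minimalPrimes hq)
    have hpbot := p.maximalIdeal_localization_eq_bot_of_mem_associatedPrimes hpa
    have hpm := p.mem_minimalPrimes_of_maximalIdeal_localization_eq_bot hpbot
    obtain ⟨hpf, hpd⟩ :=
      p.free_localizedModule_kaehlerDifferential_of_maximalIdeal_eq_bot k hpbot
    have hqd := (q.free_localizedModule_kaehlerDifferential_of_maximalIdeal_eq_bot k hqbot).2
    refine ⟨hpf, ?_⟩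
    rw [hdim p hpm] at hpd
    rw [hdim q hq] at hqd
    exact_mod_cast hpd.symm.trans hqd
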